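/- Suppose the loss ℓ(θ; z) is convex in θ ∈ ℝ^d, three times continuously differentiable in θ, with its first-, second-, and third-order derivatives in θ uniformly bounded over all θ and z, and let λ > 0. For a dataset S of size s and points z_1, z_2, let θ̂_{S∪{z_1,z_2}} be the unique minimizer of (1/(s+2))·Σ_{z ∈ S∪{z_1,z_2}} ℓ(θ; z) + (λ/2)‖θ‖², and let θ̃_S be the unique minimizer of (1/(s+2))·Σ_{z ∈ S} ℓ(θ; z) + (λ/2)‖θ‖². Then there is a constant C (depending only on λ and the derivative bounds, not on s, S, z_1, z_2) such that: (1) ‖θ̂_{S∪{z_1,z_2}} − θ̃_S‖ ≤ C/s; and (2) ‖θ̂_{S∪{z_1,z_2}} − θ̃_S + H_{θ̃_S}^{−1}[∇_θ ℓ(θ̃_S; z_1) + ∇_θ ℓ(θ̃_S; z_2)]/(s+2)‖ ≤ C/s², where H_{θ̃_S} = (1/(s+2))·Σ_{z ∈ S} ∇²_θ ℓ(θ̃_S; z) + λI. -/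

import Mathlib

open scoped InnerProductSpace

section

variable {E : Type*} [NormedAddCommGroup E] [InnerProductSpace ℝ E]

theorem mul_norm_le_norm_of_mul_sq_le_inner {m : ℝ} {v w : E}
    (h : m * ‖v‖ ^ 2 ≤ ⟪w, v⟫_ℝ) : m * ‖v‖ ≤ ‖w‖ := by
  rcases (norm_nonneg v).eq_or_lt with h0 | h0
  · simp [← h0]
  · have := real_inner_le_norm w v
    exact le_of_mul_le_mul_right (by nlinarith) h0

theorem isUnit_of_mul_sq_le_inner [FiniteDimensional ℝ E] {m : ℝ} (hm : 0 < m) {T : E →L[ℝ] E}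
    (h : ∀ v, m * ‖v‖ ^ 2 ≤ ⟪T v, v⟫_ℝ) : IsUnit T := by
  rw [ContinuousLinearMap.isUnit_iff_isUnit_toLinearMap, LinearMap.isUnit_iff_ker_eq_bot,
    LinearMap.ker_eq_bot']
  intro v hv
  have h1 := mul_norm_le_norm_of_mul_sq_le_inner (h v)
  have h2 : T v = 0 := hv
  rw [h2, norm_zero] at h1
  exact norm_le_zero_iff.mp (by nlinarith [norm_nonneg v])

theorem mul_norm_add_smul_inverse_le [FiniteDimensional ℝ E] {m : ℝ} (hm : 0 < m) {T : E →L[ℝ] E}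
    (h : ∀ v, m * ‖v‖ ^ 2 ≤ ⟪T v, v⟫_ℝ) (c : ℝ) (u w : E) :
    m * ‖u + c • Ring.inverse T w‖ ≤ ‖T u + c • w‖ := by
  have hT : T (Ring.inverse T w) = w := by
    simpa using congrArg (fun A : E →L[ℝ] E => A w)
      (Ring.mul_inverse_cancel T (isUnit_of_mul_sq_le_inner hm h))
  simpa [hT] using mul_norm_le_norm_of_mul_sq_le_inner (h (u + c • Ring.inverse T w))

section Taylor

variable {F : Type*} [NormedAddCommGroup F] [NormedSpace ℝ F] {g : E → F} {B : ℝ}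

theorem norm_sub_le_of_norm_fderiv_le (hg : Differentiable ℝ g) (hB : ∀ x, ‖fderiv ℝ g x‖ ≤ B)
    (x y : E) : ‖g y - g x‖ ≤ B * ‖y - x‖ :=
  convex_univ.norm_image_sub_le_of_norm_fderiv_le (𝕜 := ℝ) (fun z _ => hg z) (fun z _ => hB z)
    (Set.mem_univ x) (Set.mem_univ y)

theorem norm_sub_sub_fderiv_le_of_norm_fderiv_fderiv_le (hg : Differentiable ℝ g)
    (hg' : Differentiable ℝ (fderiv ℝ g)) (hB : ∀ x, ‖fderiv ℝ (fderiv ℝ g) x‖ ≤ B) (x y : E) :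
    ‖g y - g x - fderiv ℝ g x (y - x)‖ ≤ B * ‖y - x‖ ^ 2 := by
  have hB0 : 0 ≤ B := (norm_nonneg (fderiv ℝ (fderiv ℝ g) x)).trans (hB x)
  have := (convex_closedBall x ‖y - x‖).norm_image_sub_le_of_norm_fderiv_le' (𝕜 := ℝ) (f := g)
    (φ := fderiv ℝ g x) (C := B * ‖y - x‖) (x := x) (y := y) (fun z _ => hg z)
    (fun z hz => (norm_sub_le_of_norm_fderiv_le hg' hB x z).trans
      (mul_le_mul_of_nonneg_left (mem_closedBall_iff_norm.mp hz) hB0))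
    (Metric.mem_closedBall_self (norm_nonneg _)) (mem_closedBall_iff_norm.mpr le_rfl)
  calc _ ≤ _ := this
    _ = _ := by ring

end Taylor

section Gradient

variable [CompleteSpace E] {f : E → ℝ}

theorem ConvexOn.monotone_inner_gradient (hf : ConvexOn ℝ Set.univ f) (hd : Differentiable ℝ f)
    (x v : E) : Monotone fun t : ℝ => ⟪gradient f (x + t • v), v⟫_ℝ := by
  have hline (t : ℝ) : HasDerivAt (fun t : ℝ => x + t • v) v t := by
    simpa using ((hasDerivAt_id t).smul_const v).const_add x
  have hderiv (t : ℝ) :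
      HasDerivAt (fun t : ℝ => f (x + t • v)) ⟪gradient f (x + t • v), v⟫_ℝ t := by
    rw [inner_gradient_left]
    exact (hd (x + t • v)).hasFDerivAt.comp_hasDerivAt t (hline t)
  have hconv : ConvexOn ℝ Set.univ fun t : ℝ => f (x + t • v) := by
    have := hf.comp_affineMap (AffineMap.lineMap x (x + v))
    simpa [Function.comp_def, AffineMap.lineMap_apply, add_comm] using this
  have hmono := hconv.monotoneOn_deriv fun t _ => (hderiv t).differentiableAt
  rw [monotoneOn_univ, funext fun t => (hderiv t).deriv] at hmono
  exact hmono

theorem ConvexOn.inner_gradient_sub_nonneg (hf : ConvexOn ℝ Set.univ f) (hd : Differentiable ℝ f)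
    (x y : E) : 0 ≤ ⟪gradient f y - gradient f x, y - x⟫_ℝ := by
  have := hf.monotone_inner_gradient hd x (y - x) zero_le_one
  simp only [zero_smul, add_zero, one_smul, add_sub_cancel] at this
  rw [inner_sub_left]
  linarith

theorem ConvexOn.inner_fderiv_gradient_nonneg (hf : ConvexOn ℝ Set.univ f)
    (hd : Differentiable ℝ f) (hg : Differentiable ℝ (gradient f)) (x v : E) :
    0 ≤ ⟪fderiv ℝ (gradient f) x v, v⟫_ℝ := by
  have hline : HasDerivAt (fun t : ℝ => x + t • v) v 0 := by
    simpa using ((hasDerivAt_id (0 : ℝ)).smul_const v).const_add x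
  have hx : HasFDerivAt (gradient f) (fderiv ℝ (gradient f) x) (x + (0 : ℝ) • v) := by
    simpa using (hg x).hasFDerivAt
  have h := (hx.comp_hasDerivAt (0 : ℝ) hline).inner ℝ (hasDerivAt_const (0 : ℝ) v)
  have h0 := (hf.monotone_inner_gradient hd x v).deriv_nonneg (x := 0)
  simpa [Function.comp_def] using h0.trans_eq h.deriv

theorem ContDiff.gradient {n m : WithTop ℕ∞} (hf : ContDiff ℝ n f) (hmn : m + 1 ≤ n) :
    ContDiff ℝ m (gradient f) :=
  (InnerProductSpace.toDual ℝ E).symm.toContinuousLinearEquiv.contDiff.comp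
    (hf.fderiv_right hmn)

theorem HasGradientAt.add_half_mul_norm_sq {g x : E} (hf : HasGradientAt f g x) (c m : ℝ) :
    HasGradientAt (fun y => c * f y + m / 2 * ‖y‖ ^ 2) (c • g + m • x) x := by
  rw [hasGradientAt_iff_hasFDerivAt] at hf ⊢
  refine ((hf.const_mul c).add
    ((hasStrictFDerivAt_norm_sq x).hasFDerivAt.const_mul (m / 2))).congr_fderiv ?_
  ext v
  simp
  ring

theorem HasGradientAt.fun_add {h : E → ℝ} {g k x : E} (hf : HasGradientAt f g x)
    (hh : HasGradientAt h k x) : HasGradientAt (fun y => f y + h y) (g + k) x := by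
  rw [hasGradientAt_iff_hasFDerivAt] at *
  simpa using HasFDerivAt.fun_add hf hh

theorem HasGradientAt.fun_sum {ι : Type*} {s : Finset ι} {f : ι → E → ℝ} {g : ι → E} {x : E}
    (h : ∀ i ∈ s, HasGradientAt (f i) (g i) x) :
    HasGradientAt (fun y => ∑ i ∈ s, f i y) (∑ i ∈ s, g i) x := by
  simp only [hasGradientAt_iff_hasFDerivAt] at *
  simpa using HasFDerivAt.fun_sum h

theorem IsMinOn.gradient_eq_zero {g x : E} (h : IsMinOn f Set.univ x) (hf : HasGradientAt f g x) :
    g = 0 := by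
  have := (h.isLocalMin Filter.univ_mem).hasFDerivAt_eq_zero hf.hasFDerivAt
  simpa using this

end Gradient

end


/-- Influence-function expansion of the regularized empirical risk minimizer:
if `θ̂` minimizes the loss over `S ∪ {z1, z2}` (with denominator `s+2`) and `θ̃`
minimizes the loss over `S` (with the same denominator `s+2`), then
(1) `‖θ̂ − θ̃‖ ≤ C/s` and
(2) `‖θ̂ − θ̃ + H_{θ̃}⁻¹[∇ℓ(θ̃; z1) + ∇ℓ(θ̃; z2)]/(s+2)‖ ≤ C/s²`,
for a constant `C` depending only on `λ` and the derivative bounds. -/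
theorem influence_function_parameter_expansion {d : ℕ} {Z : Type}
    (L : EuclideanSpace ℝ (Fin d) → Z → ℝ) (lam B : ℝ) (hlam : 0 < lam) (hB : 0 < B)
    (hconv : ∀ z : Z, ConvexOn ℝ Set.univ fun θ => L θ z)
    (hC3 : ∀ z : Z, ContDiff ℝ 3 fun θ => L θ z)
    (hd1 : ∀ (θ : EuclideanSpace ℝ (Fin d)) (z : Z),
      ‖gradient (fun θ' => L θ' z) θ‖ ≤ B)
    (hd2 : ∀ (θ : EuclideanSpace ℝ (Fin d)) (z : Z),
      ‖fderiv ℝ (gradient fun θ' => L θ' z) θ‖ ≤ B)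
    (hd3 : ∀ (θ : EuclideanSpace ℝ (Fin d)) (z : Z),
      ‖fderiv ℝ (fderiv ℝ (gradient fun θ' => L θ' z)) θ‖ ≤ B) :
    ∃ C : ℝ, ∀ s : ℕ, 1 ≤ s → ∀ (zS : Fin s → Z) (z1 z2 : Z)
      (θhat θtilde : EuclideanSpace ℝ (Fin d)),
      IsMinOn (fun θ => 1 / ((s : ℝ) + 2) * ((∑ i, L θ (zS i)) + L θ z1 + L θ z2) +
        lam / 2 * ‖θ‖ ^ 2) Set.univ θhat →
      IsMinOn (fun θ => 1 / ((s : ℝ) + 2) * (∑ i, L θ (zS i)) +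
        lam / 2 * ‖θ‖ ^ 2) Set.univ θtilde →
      ‖θhat - θtilde‖ ≤ C / (s : ℝ) ∧
      ‖θhat - θtilde +
          (1 / ((s : ℝ) + 2)) •
            Ring.inverse
              ((1 / ((s : ℝ) + 2)) •
                  (∑ i, fderiv ℝ (gradient fun θ' => L θ' (zS i)) θtilde) +
                lam • ContinuousLinearMap.id ℝ (EuclideanSpace ℝ (Fin d)))
              (gradient (fun θ' => L θ' z1) θtilde +
                gradient (fun θ' => L θ' z2) θtilde)‖ ≤
        C / (s : ℝ) ^ 2 := by
  have hdiff (z : Z) : Differentiable ℝ fun θ => L θ z := (hC3 z).differentiable (by norm_num)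
  have hG2 (z : Z) : ContDiff ℝ 2 (gradient fun θ => L θ z) := (hC3 z).gradient (by norm_num)
  have hG (z : Z) : Differentiable ℝ (gradient fun θ => L θ z) :=
    (hG2 z).differentiable (by norm_num)
  have hG' (z : Z) : Differentiable ℝ (fderiv ℝ (gradient fun θ => L θ z)) :=
    ((hG2 z).fderiv_right (m := 1) (by norm_num)).differentiable (by norm_num)
  have hgrad (z : Z) (θ : EuclideanSpace ℝ (Fin d)) :
      HasGradientAt (fun θ => L θ z) (gradient (fun θ' => L θ' z) θ) θ :=
    (hdiff z θ).hasGradientAt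
  set D : ℝ := 2 * B / lam with hD
  set K : ℝ := (B * D ^ 2 + 2 * B * D) / lam with hK
  have hD0 : 0 ≤ D := by positivity
  have hK0 : 0 ≤ K := by positivity
  refine ⟨D + K, fun s hs zS z1 z2 x y hx hy => ?_⟩
  have hs0 : (0 : ℝ) < s := by exact_mod_cast hs
  set c : ℝ := 1 / ((s : ℝ) + 2) with hc
  have hc0 : 0 < c := by positivity
  have hcs : c * s ≤ 1 := by
    rw [hc, div_mul_eq_mul_div, div_le_one (by positivity)]
    linarith
  have hcs' : c ≤ 1 / s := one_div_le_one_div_of_le hs0 (by linarith)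
  set g : Z → EuclideanSpace ℝ (Fin d) → EuclideanSpace ℝ (Fin d) :=
    fun z => gradient fun θ => L θ z
  have hFx : c • ((∑ i, g (zS i) x) + g z1 x + g z2 x) + lam • x = 0 :=
    hx.gradient_eq_zero ((((HasGradientAt.fun_sum fun i _ => hgrad (zS i) x).fun_add
      (hgrad z1 x)).fun_add (hgrad z2 x)).add_half_mul_norm_sq c lam)
  have hFy : c • (∑ i, g (zS i) y) + lam • y = 0 :=
    hy.gradient_eq_zero
      ((HasGradientAt.fun_sum fun i _ => hgrad (zS i) y).add_half_mul_norm_sq c lam)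
  have hdist : lam * ‖x - y‖ ≤ c * (2 * B) := by
    have hmono : lam * ‖x - y‖ ^ 2 ≤
        ⟪c • (∑ i, (g (zS i) x - g (zS i) y)) + lam • (x - y), x - y⟫_ℝ := by
      rw [inner_add_left, real_inner_smul_left, real_inner_smul_left, sum_inner,
        real_inner_self_eq_norm_sq]
      have := Finset.sum_nonneg fun i (_ : i ∈ Finset.univ) =>
        (hconv (zS i)).inner_gradient_sub_nonneg (hdiff (zS i)) y x
      exact le_add_of_nonneg_left (mul_nonneg hc0.le this)
    have heq : c • (∑ i, (g (zS i) x - g (zS i) y)) + lam • (x - y) =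
        -(c • (g z1 x + g z2 x)) := by
      rw [Finset.sum_sub_distrib]
      linear_combination (norm := module) hFx - hFy
    refine (mul_norm_le_norm_of_mul_sq_le_inner hmono).trans ?_
    rw [heq, norm_neg, norm_smul, Real.norm_of_nonneg hc0.le]
    exact mul_le_mul_of_nonneg_left
      ((norm_add_le _ _).trans (by linarith [hd1 x z1, hd1 x z2])) hc0.le
  have hdist' : ‖x - y‖ ≤ D * c := by
    rw [hD, div_mul_eq_mul_div, le_div_iff₀ hlam]
    linarith
  refine ⟨?_, ?_⟩
  · calc ‖x - y‖ ≤ D * (1 / s) := hdist'.trans (mul_le_mul_of_nonneg_left hcs' hD0)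
      _ ≤ (D + K) * (1 / s) := by gcongr; linarith
      _ = (D + K) / s := by ring
  · set H : EuclideanSpace ℝ (Fin d) →L[ℝ] EuclideanSpace ℝ (Fin d) :=
      c • (∑ i, fderiv ℝ (g (zS i)) y) + lam • ContinuousLinearMap.id ℝ _ with hH
    have hHv (v) : H v = c • (∑ i, fderiv ℝ (g (zS i)) y v) + lam • v := by
      simp [hH]
    have hcoer (v) : lam * ‖v‖ ^ 2 ≤ ⟪H v, v⟫_ℝ := by
      rw [hHv, inner_add_left, real_inner_smul_left, real_inner_smul_left, sum_inner,
        real_inner_self_eq_norm_sq]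
      have := Finset.sum_nonneg fun i (_ : i ∈ Finset.univ) =>
        (hconv (zS i)).inner_fderiv_gradient_nonneg (hdiff (zS i)) (hG (zS i)) y v
      exact le_add_of_nonneg_left (mul_nonneg hc0.le this)
    have hres : H (x - y) + c • (g z1 y + g z2 y) =
        -(c • ((∑ i, (g (zS i) x - g (zS i) y - fderiv ℝ (g (zS i)) y (x - y))) +
          ((g z1 x - g z1 y) + (g z2 x - g z2 y)))) := by
      rw [hHv, Finset.sum_sub_distrib, Finset.sum_sub_distrib]
      linear_combination (norm := module) hFx - hFy
    have hsum : ‖∑ i, (g (zS i) x - g (zS i) y - fderiv ℝ (g (zS i)) y (x - y))‖ ≤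
        s * (B * ‖x - y‖ ^ 2) := by
      refine (norm_sum_le_of_le _ fun i _ => norm_sub_sub_fderiv_le_of_norm_fderiv_fderiv_le
        (hG (zS i)) (hG' (zS i)) (fun θ => hd3 θ (zS i)) y x).trans_eq ?_
      simp
    have hlip (z : Z) : ‖g z x - g z y‖ ≤ B * ‖x - y‖ :=
      norm_sub_le_of_norm_fderiv_le (hG z) (fun θ => hd2 θ z) y x
    have hbound : ‖H (x - y) + c • (g z1 y + g z2 y)‖ ≤ (B * D ^ 2 + 2 * B * D) * c ^ 2 := by
      rw [hres, norm_neg, norm_smul, Real.norm_of_nonneg hc0.le]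
      calc _ ≤ c * (s * (B * ‖x - y‖ ^ 2) + (B * ‖x - y‖ + B * ‖x - y‖)) := by
            refine mul_le_mul_of_nonneg_left ?_ hc0.le
            exact norm_add_le_of_le hsum (norm_add_le_of_le (hlip z1) (hlip z2))
        _ = c * s * (B * ‖x - y‖ ^ 2) + 2 * B * c * ‖x - y‖ := by ring
        _ ≤ 1 * (B * (D * c) ^ 2) + 2 * B * c * (D * c) := by gcongr
        _ = _ := by ring
    have hfinal := (mul_norm_add_smul_inverse_le hlam hcoer c (x - y) (g z1 y + g z2 y)).trans
      hbound
    calc ‖x - y + c • Ring.inverse H (g z1 y + g z2 y)‖ ≤ K * c ^ 2 := by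
          rw [hK, div_mul_eq_mul_div, le_div_iff₀ hlam]
          linarith
      _ ≤ (D + K) * (1 / s) ^ 2 := by gcongr; linarith
      _ = (D + K) / (s : ℝ) ^ 2 := by ring
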